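/- Let (R,m) be a Noetherian local ring, I an ideal, N a finitely generated R-module, k ≥ -1 an integer, and r = depth_k(I,N) < ∞ with x_1,...,x_r an N-sequence in dimension > k contained in √I and a_1,...,a_s a system of generators of I. If p ∈ Ass_R(Ext^j_R(R/(a_1^{t_1},...,a_s^{t_s}), N)) for some j ≤ r, some positive integers t_1,...,t_s, and dim(R/p) ≥ k+1, then j = r and p ∈ Ass_R(N/(x_1,...,x_r)N). -/

import Mathlib

open CategoryTheory Opposite IsLocalRing

/-- Interpretation of an integer `k ≥ -1` in `WithBot ℕ∞`, for comparison with Krull dimensions. -/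
noncomputable def zdim (k : ℤ) : WithBot (WithTop ℕ) :=
  if k < 0 then ⊥ else ((k.toNat : WithTop ℕ) : WithBot (WithTop ℕ))

/-- The ideal generated by the first `j` entries of the sequence `x`. -/
def prefIdeal {R : Type} [CommRing R] {r : ℕ} (x : Fin r → R) (j : ℕ) : Ideal R :=
  Ideal.span (x '' {i | (i : ℕ) < j})

/-- `x` is an `N`-sequence in dimension `> k`: for each `i`, `x i` avoids every associated
prime `p` of `N/(x_0,…,x_{i-1})N` with `dim(R/p) > k`. -/
def IsSeqInDimGT (R : Type) [CommRing R] (N : Type) [AddCommGroup N] [Module R N]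
    (k : ℤ) {r : ℕ} (x : Fin r → R) : Prop :=
  ∀ i : Fin r, ∀ p ∈ associatedPrimes R (N ⧸ (prefIdeal x (i : ℕ) • ⊤ : Submodule R N)),
    zdim k < ringKrullDim (R ⧸ p) → x i ∉ p

/-- `depth_k(I,N)`: the common length of maximal `N`-sequences in dimension `> k`
contained in `I` (realized as the supremum of lengths of such sequences). -/
noncomputable def depthK (R : Type) [CommRing R] (k : ℤ) (I : Ideal R)
    (N : Type) [AddCommGroup N] [Module R N] : ℕ∞ :=
  sSup {n : ℕ∞ | ∃ (r : ℕ) (x : Fin r → R),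
    (∀ i, x i ∈ I) ∧ IsSeqInDimGT R N k x ∧ n = (r : ℕ∞)}

/-- The set of prime (or arbitrary) ideals `p` with `dim(R/p) ≥ k`. -/
def dimGE (R : Type) [CommRing R] (k : ℤ) : Set (Ideal R) :=
  {p | zdim k ≤ ringKrullDim (R ⧸ p)}


section

variable {R : Type} [CommRing R]

/-- If every associated prime of `M` contained in `p` avoids `x`, then the elements of `M` killed
by `x` are killed by a common element outside `p`. -/
lemma exists_notMem_smul_eq_zero_of_associatedPrimes [IsNoetherianRing R]
    {M : Type} [AddCommGroup M] [Module R M] [Module.Finite R M] {p : Ideal R} [p.IsPrime] {x : R}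
    (h : ∀ q ∈ associatedPrimes R M, q ≤ p → x ∉ q) :
    ∃ t ∉ p, ∀ m : M, x • m = 0 → t • m = 0 := by
  let K : Submodule R M := LinearMap.ker (LinearMap.lsmul R M x)
  have hK : ¬ Module.annihilator R K ≤ p := by
    intro hle
    obtain ⟨q, hq, hqp⟩ := Ideal.exists_minimalPrimes_le hle
    refine h q (associatedPrimes.subset_of_injective K.injective_subtype
      (Module.associatedPrimes.minimalPrimes_annihilator_subset_associatedPrimes R K hq)) hqp
      (hq.1.2 ?_)
    rw [Module.mem_annihilator]
    rintro ⟨m, hm⟩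
    exact Subtype.ext (by simpa [K] using hm)
  obtain ⟨t, ht, htp⟩ := Set.not_subset.mp hK
  refine ⟨t, htp, fun m hm ↦ ?_⟩
  exact congrArg Subtype.val (Module.mem_annihilator.mp ht ⟨m, by simpa [K] using hm⟩)

/-- A prime `p` is associated to `M` as soon as it is locally at `p` the annihilator of an
element. -/
lemma mem_associatedPrimes_of_forall_mem_iff [IsNoetherianRing R]
    {M : Type} [AddCommGroup M] [Module R M] {p : Ideal R} [p.IsPrime] {m : M}
    (h : ∀ c, c ∈ p ↔ ∃ t ∉ p, t • c • m = 0) : p ∈ associatedPrimes R M := by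
  let K : Submodule R M := R ∙ m
  have mem_ann {c : R} : c ∈ Module.annihilator R K ↔ c • m = 0 :=
    Submodule.mem_annihilator_span_singleton m c
  refine associatedPrimes.subset_of_injective K.injective_subtype
    (Module.associatedPrimes.minimalPrimes_annihilator_subset_associatedPrimes R K
      ⟨⟨‹_›, fun c hc ↦ (h c).2 ⟨1, p.one_notMem, ?_⟩⟩, ?_⟩)
  · rw [one_smul, mem_ann.mp hc]
  · rintro q ⟨hq, hKq⟩ hqp c hc
    obtain ⟨t, ht, htc⟩ := (h c).1 hc
    exact (hq.mem_or_mem (hKq (mem_ann.mpr (by rwa [mul_smul])))).resolve_left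
      fun htq ↦ ht (hqp htq)

variable {P : ℕ → Type} [∀ n, AddCommGroup (P n)] [∀ n, Module R (P n)]
  (d : ∀ n, P (n + 1) →ₗ[R] P n)
  {N N' : Type} [AddCommGroup N] [Module R N] [AddCommGroup N'] [Module R N']

/-- The coboundaries of the cochain complex `Hom(P, N)`. -/
def homCoboundaries (N : Type) [AddCommGroup N] [Module R N] :
    (n : ℕ) → Submodule R (P n →ₗ[R] N)
  | 0 => ⊥
  | n + 1 => LinearMap.range (LinearMap.lcomp R N (d n))

/-- The `n`-th cohomology of `Hom(P, N)` vanishes locally at `p`. -/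
def HomCohomologyVanishesAt (p : Ideal R) (N : Type) [AddCommGroup N] [Module R N] (n : ℕ) : Prop :=
  ∀ f : P n →ₗ[R] N, f ∘ₗ d n = 0 → ∃ t ∉ p, t • f ∈ homCoboundaries d N n

/-- The cocycle `f` of `Hom(P, N)` represents a class whose annihilator is, locally at `p`, the
ideal `p`. -/
structure IsAssociatedCocycle (p : Ideal R) {N : Type} [AddCommGroup N] [Module R N] {n : ℕ}
    (f : P n →ₗ[R] N) : Prop where
  comp_eq_zero : f ∘ₗ d n = 0
  mem_iff (c : R) : c ∈ p ↔ ∃ t ∉ p, t • c • f ∈ homCoboundaries d N n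

variable {d}

lemma comp_eq_zero_of_mem_homCoboundaries (hd : ∀ n, d n ∘ₗ d (n + 1) = 0) {n : ℕ}
    {f : P n →ₗ[R] N} (hf : f ∈ homCoboundaries d N n) : f ∘ₗ d n = 0 := by
  cases n with
  | zero => rw [(Submodule.mem_bot R).mp hf, LinearMap.zero_comp]
  | succ n =>
    obtain ⟨g, rfl⟩ := hf
    rw [LinearMap.lcomp_apply', LinearMap.comp_assoc, hd, LinearMap.comp_zero]

lemma comp_mem_homCoboundaries (φ : N →ₗ[R] N') {n : ℕ} {f : P n →ₗ[R] N}
    (hf : f ∈ homCoboundaries d N n) : φ ∘ₗ f ∈ homCoboundaries d N' n := by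
  cases n with
  | zero =>
    rw [(Submodule.mem_bot R).mp hf, LinearMap.comp_zero]
    exact zero_mem _
  | succ n =>
    obtain ⟨g, rfl⟩ := hf
    exact ⟨φ ∘ₗ g, rfl⟩

lemma IsAssociatedCocycle.of_linearEquiv (e : N ≃ₗ[R] N') {p : Ideal R} {n : ℕ} {f : P n →ₗ[R] N}
    (hf : IsAssociatedCocycle d p f) : IsAssociatedCocycle d p (e.toLinearMap ∘ₗ f) where
  comp_eq_zero := by rw [LinearMap.comp_assoc, hf.comp_eq_zero, LinearMap.comp_zero]
  mem_iff c := by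
    rw [hf.mem_iff]
    refine exists_congr fun t ↦ and_congr_right fun _ ↦ ⟨fun h ↦ ?_, fun h ↦ ?_⟩
    · simpa only [LinearMap.comp_smul] using comp_mem_homCoboundaries e.toLinearMap h
    · have := comp_mem_homCoboundaries e.symm.toLinearMap h
      simpa only [LinearMap.comp_smul, ← LinearMap.comp_assoc, LinearEquiv.symm_comp,
        LinearMap.id_comp] using this

section Step

variable [∀ n, Module.Projective R (P n)] {π : N →ₗ[R] N'} {x : R} {p : Ideal R}

lemma exists_eq_smul_of_comp_eq_zero {Q : Type} [AddCommGroup Q] [Module R Q]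
    [Module.Projective R Q] (hker : LinearMap.ker π = LinearMap.range (LinearMap.lsmul R N x))
    {f : Q →ₗ[R] N} (hf : π ∘ₗ f = 0) : ∃ u : Q →ₗ[R] N, f = x • u := by
  have hmem (q : Q) : f q ∈ LinearMap.range (LinearMap.lsmul R N x) := by
    rw [← hker]
    exact LinearMap.congr_fun hf q
  obtain ⟨u, hu⟩ := Module.projective_lifting_property (LinearMap.lsmul R N x).rangeRestrict
    (f.codRestrict _ hmem) (LinearMap.surjective_rangeRestrict _)
  refine ⟨u, LinearMap.ext fun q ↦ ?_⟩
  exact (congrArg Subtype.val (LinearMap.congr_fun hu q)).symm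

lemma exists_eq_add_smul_of_comp_mem_homCoboundaries (hπ : Function.Surjective π)
    (hker : LinearMap.ker π = LinearMap.range (LinearMap.lsmul R N x)) {n : ℕ} {f : P n →ₗ[R] N}
    (hf : π ∘ₗ f ∈ homCoboundaries d N' n) :
    ∃ b ∈ homCoboundaries d N n, ∃ u : P n →ₗ[R] N, f = b + x • u := by
  cases n with
  | zero =>
    obtain ⟨u, hu⟩ := exists_eq_smul_of_comp_eq_zero hker ((Submodule.mem_bot R).mp hf)
    exact ⟨0, zero_mem _, u, by rw [hu, zero_add]⟩
  | succ n =>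
    obtain ⟨h', hh'⟩ := hf
    obtain ⟨h, rfl⟩ := Module.projective_lifting_property π h' hπ
    obtain ⟨u, hu⟩ := exists_eq_smul_of_comp_eq_zero (f := f - h ∘ₗ d n) hker (by
      rw [LinearMap.comp_sub, ← hh', LinearMap.lcomp_apply', LinearMap.comp_assoc, sub_self])
    exact ⟨h ∘ₗ d n, ⟨h, rfl⟩, u, by rw [← hu, add_sub_cancel]⟩

variable [p.IsPrime]

private lemma mul_notMem {t u : R} (ht : t ∉ p) (hu : u ∉ p) : t * u ∉ p :=
  p.primeCompl.mul_mem ht hu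

lemma exists_smul_mem_homCoboundaries_of_smul_mem
    (hd : ∀ n, d n ∘ₗ d (n + 1) = 0) (hπ : Function.Surjective π)
    (hker : LinearMap.ker π = LinearMap.range (LinearMap.lsmul R N x))
    (hx : ∃ t ∉ p, ∀ y : N, x • y = 0 → t • y = 0) {n : ℕ}
    (hN' : ∀ m, n = m + 1 → HomCohomologyVanishesAt d p N' m)
    {f : P n →ₗ[R] N} (hf : x • f ∈ homCoboundaries d N n) :
    ∃ t ∉ p, t • f ∈ homCoboundaries d N n := by
  obtain ⟨t, ht, hxt⟩ := hx
  have hmap {Q : Type} [AddCommGroup Q] [Module R Q] {g : Q →ₗ[R] N} (hg : x • g = 0) :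
      t • g = 0 := LinearMap.ext fun q ↦ hxt _ (LinearMap.congr_fun hg q)
  cases n with
  | zero => exact ⟨t, ht, (Submodule.mem_bot R).mpr (hmap ((Submodule.mem_bot R).mp hf))⟩
  | succ n =>
    obtain ⟨g, hg⟩ := hf
    rw [LinearMap.lcomp_apply'] at hg
    have hπx {Q : Type} [AddCommGroup Q] [Module R Q] (u : Q →ₗ[R] N) : π ∘ₗ (x • u) = 0 :=
      LinearMap.ext fun q ↦ hker.ge ⟨u q, rfl⟩
    obtain ⟨t', ht', hB⟩ := hN' n rfl (π ∘ₗ g) (by rw [LinearMap.comp_assoc, hg, hπx])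
    rw [← LinearMap.comp_smul] at hB
    obtain ⟨b, hb, u, hu⟩ := exists_eq_add_smul_of_comp_mem_homCoboundaries hπ hker hB
    have key : x • (t' • f - u ∘ₗ d n) = 0 := by
      have := congrArg (· ∘ₗ d n) hu
      simp only [LinearMap.smul_comp, LinearMap.add_comp, hg,
        comp_eq_zero_of_mem_homCoboundaries hd hb, zero_add] at this
      rw [smul_sub, smul_comm, this, sub_self]
    refine ⟨t * t', mul_notMem ht ht', t • u, ?_⟩
    have := hmap key
    rw [smul_sub, sub_eq_zero] at this
    rw [mul_smul, this]
    rfl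

lemma HomCohomologyVanishesAt.of_pow_smul_mem
    (hd : ∀ n, d n ∘ₗ d (n + 1) = 0) (hπ : Function.Surjective π)
    (hker : LinearMap.ker π = LinearMap.range (LinearMap.lsmul R N x))
    (hx : ∃ t ∉ p, ∀ y : N, x • y = 0 → t • y = 0) {n : ℕ}
    (hN' : ∀ m, n = m + 1 → HomCohomologyVanishesAt d p N' m) (k : ℕ)
    (hk : ∀ f : P n →ₗ[R] N, f ∘ₗ d n = 0 → x ^ k • f ∈ homCoboundaries d N n) :
    HomCohomologyVanishesAt d p N n := by
  intro f hf
  suffices h : ∀ k (g : P n →ₗ[R] N), x ^ k • g ∈ homCoboundaries d N n →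
      ∃ t ∉ p, t • g ∈ homCoboundaries d N n from h k f (hk f hf)
  intro k
  induction k with
  | zero => exact fun g hg ↦ ⟨1, p.one_notMem, by simpa using hg⟩
  | succ k ih =>
    intro g hg
    rw [pow_succ', mul_smul] at hg
    obtain ⟨t, ht, h⟩ := exists_smul_mem_homCoboundaries_of_smul_mem hd hπ hker hx hN' hg
    rw [smul_comm] at h
    obtain ⟨t', ht', h'⟩ := ih _ h
    exact ⟨t' * t, mul_notMem ht' ht, by rwa [mul_smul]⟩

lemma IsAssociatedCocycle.exists_of_succ
    (hd : ∀ n, d n ∘ₗ d (n + 1) = 0) (hπ : Function.Surjective π)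
    (hker : LinearMap.ker π = LinearMap.range (LinearMap.lsmul R N x))
    (hx : ∃ t ∉ p, ∀ y : N, x • y = 0 → t • y = 0) (hxp : x ∈ p) {n : ℕ}
    (hN : HomCohomologyVanishesAt d p N n) {f : P (n + 1) →ₗ[R] N}
    (hf : IsAssociatedCocycle d p f) : ∃ g : P n →ₗ[R] N', IsAssociatedCocycle d p g := by
  have hπx {Q : Type} [AddCommGroup Q] [Module R Q] (u : Q →ₗ[R] N) : π ∘ₗ (x • u) = 0 :=
    LinearMap.ext fun q ↦ hker.ge ⟨u q, rfl⟩
  obtain ⟨s, hs, g, hg⟩ := (hf.mem_iff x).1 hxp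
  rw [LinearMap.lcomp_apply'] at hg
  refine ⟨π ∘ₗ g, ?_, fun c ↦ ⟨fun hc ↦ ?_, ?_⟩⟩
  · rw [LinearMap.comp_assoc, hg, smul_comm, hπx]
  · obtain ⟨t, ht, u, hu⟩ := (hf.mem_iff c).1 hc
    rw [LinearMap.lcomp_apply'] at hu
    obtain ⟨t', ht', h⟩ := hN (t • c • g - x • s • u) (by
      rw [LinearMap.sub_comp]
      simp only [LinearMap.smul_comp, hg, hu]
      module)
    refine ⟨t' * t, mul_notMem ht' ht, ?_⟩
    have := comp_mem_homCoboundaries π h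
    rwa [LinearMap.comp_smul, LinearMap.comp_sub, hπx, sub_zero, LinearMap.comp_smul,
      LinearMap.comp_smul, ← mul_smul] at this
  · rintro ⟨t, ht, h⟩
    rw [← LinearMap.comp_smul, ← LinearMap.comp_smul] at h
    obtain ⟨b, hb, u, hu⟩ := exists_eq_add_smul_of_comp_mem_homCoboundaries hπ hker h
    obtain ⟨t', ht', hxt⟩ := hx
    have key : x • (t • s • c • f - u ∘ₗ d n) = 0 := by
      have := congrArg (· ∘ₗ d n) hu
      simp only [LinearMap.smul_comp, LinearMap.add_comp, hg,
        comp_eq_zero_of_mem_homCoboundaries hd hb, zero_add] at this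
      rw [smul_sub, ← this]
      module
    have key' : t' • (t • s • c • f - u ∘ₗ d n) = 0 :=
      LinearMap.ext fun q ↦ hxt _ (LinearMap.congr_fun key q)
    rw [smul_sub, sub_eq_zero] at key'
    refine (hf.mem_iff c).2 ⟨t' * (t * s), mul_notMem ht' (mul_notMem ht hs), t' • u, ?_⟩
    rw [mul_smul, mul_smul, key']
    rfl

end Step

/-- In degree zero, associated cocycles of `Hom(P, N)` give associated primes of `N` when `P`
resolves a cyclic module. -/
lemma IsAssociatedCocycle.mem_associatedPrimes [IsNoetherianRing R] {J p : Ideal R} [p.IsPrime]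
    {ε : P 0 →ₗ[R] R ⧸ J} (hε : Function.Surjective ε)
    (hex : LinearMap.ker ε ≤ LinearMap.range (d 0)) {f : P 0 →ₗ[R] N}
    (hf : IsAssociatedCocycle d p f) : p ∈ associatedPrimes R N := by
  have hle : LinearMap.ker ε ≤ LinearMap.ker f := by
    refine hex.trans ?_
    rintro _ ⟨q, rfl⟩
    exact LinearMap.congr_fun hf.comp_eq_zero q
  obtain ⟨e, he⟩ := hε 1
  refine mem_associatedPrimes_of_forall_mem_iff (m := f e) fun c ↦ ?_
  rw [hf.mem_iff]
  refine exists_congr fun t ↦ and_congr_right fun _ ↦ ?_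
  refine ⟨fun h ↦ LinearMap.congr_fun ((Submodule.mem_bot R).mp h) e, fun h ↦
    (Submodule.mem_bot R).mpr (LinearMap.ext fun q ↦ ?_)⟩
  obtain ⟨b, hb⟩ := Ideal.Quotient.mk_surjective (ε q)
  have hq : q - b • e ∈ LinearMap.ker f := hle (by
    rw [LinearMap.mem_ker, map_sub, map_smul, he, ← hb, Algebra.smul_def, mul_one]
    exact sub_self _)
  rw [LinearMap.mem_ker, map_sub, sub_eq_zero, map_smul] at hq
  simp only [LinearMap.smul_apply, LinearMap.zero_apply, hq]
  rw [smul_comm c b, smul_comm t b, h, smul_zero]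

end

section

variable {R : Type} [CommRing R]

lemma prefIdeal_zero {r : ℕ} (x : Fin r → R) : prefIdeal x 0 = ⊥ := by
  simp [prefIdeal]

lemma prefIdeal_succ {r : ℕ} (x : Fin r → R) (i : Fin r) :
    prefIdeal x (i + 1) = prefIdeal x i ⊔ Ideal.span {x i} := by
  rw [prefIdeal, prefIdeal, ← Ideal.span_union]
  congr 1
  have : {l : Fin r | (l : ℕ) < i + 1} = {l : Fin r | (l : ℕ) < i} ∪ {i} := by
    ext l
    simp only [Set.mem_ofPred_eq, Set.mem_union, Set.mem_singleton_iff, Fin.ext_iff]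
    lia
  rw [this, Set.image_union, Set.image_singleton]

variable {N : Type} [AddCommGroup N] [Module R N]

lemma exists_surjective_ker_eq_range_lsmul {r : ℕ} (x : Fin r → R) (i : Fin r) :
    ∃ π : (N ⧸ (prefIdeal x i • ⊤ : Submodule R N)) →ₗ[R]
        (N ⧸ (prefIdeal x (i + 1) • ⊤ : Submodule R N)),
      Function.Surjective π ∧ LinearMap.ker π = LinearMap.range (LinearMap.lsmul R _ (x i)) := by
  have hsup : (prefIdeal x (i + 1) • ⊤ : Submodule R N) =
      prefIdeal x i • ⊤ ⊔ Ideal.span {x i} • ⊤ := by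
    rw [prefIdeal_succ, Submodule.sup_smul]
  have hle : (prefIdeal x i • ⊤ : Submodule R N) ≤ prefIdeal x (i + 1) • ⊤ := hsup ▸ le_sup_left
  refine ⟨Submodule.factor hle, Submodule.factor_surjective hle, ?_⟩
  ext y
  obtain ⟨n, rfl⟩ := Submodule.Quotient.mk_surjective _ y
  rw [LinearMap.mem_ker, LinearMap.mem_range]
  change Submodule.Quotient.mk n = 0 ↔ _
  rw [Submodule.Quotient.mk_eq_zero, hsup, Submodule.mem_sup]
  constructor
  · rintro ⟨b, hb, c, hc, rfl⟩
    rw [Submodule.ideal_span_singleton_smul, Submodule.mem_smul_pointwise_iff_exists] at hc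
    obtain ⟨m, -, rfl⟩ := hc
    refine ⟨Submodule.Quotient.mk m, ?_⟩
    rw [Submodule.Quotient.mk_add, (Submodule.Quotient.mk_eq_zero _).2 hb, zero_add]
    rfl
  · rintro ⟨z, hz⟩
    obtain ⟨m, rfl⟩ := Submodule.Quotient.mk_surjective _ z
    refine ⟨n - x i • m, ?_, x i • m,
      Submodule.smul_mem_smul (Ideal.mem_span_singleton_self _) trivial, sub_add_cancel _ _⟩
    rw [← Submodule.Quotient.mk_eq_zero, Submodule.Quotient.mk_sub, ← hz]
    exact sub_self _

lemma zdim_lt_of_zdim_add_one_le {k : ℤ} (hk : -1 ≤ k) {D : WithBot (WithTop ℕ)}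
    (h : zdim (k + 1) ≤ D) : zdim k < D := by
  refine lt_of_lt_of_le ?_ h
  obtain rfl | hk := hk.eq_or_lt
  · exact WithBot.bot_lt_coe _
  · lift k to ℕ using by lia
    have : ((k : ℤ) + 1).toNat = k + 1 := by lia
    rw [zdim, zdim, if_neg (by lia), if_neg (by lia), this, Int.toNat_natCast]
    exact WithBot.coe_lt_coe.2 (WithTop.coe_lt_coe.2 k.lt_succ_self)

/-- An `N`-sequence in dimension `> k` is regular up to torsion at each prime of dimension `> k`. -/
lemma IsSeqInDimGT.exists_notMem_smul_eq_zero [IsNoetherianRing R] [Module.Finite R N] {k : ℤ}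
    {r : ℕ} {x : Fin r → R} (hx : IsSeqInDimGT R N k x) {p : Ideal R} [p.IsPrime]
    (hp : zdim k < ringKrullDim (R ⧸ p)) (i : Fin r) :
    ∃ t ∉ p, ∀ y : N ⧸ (prefIdeal x i • ⊤ : Submodule R N), x i • y = 0 → t • y = 0 :=
  exists_notMem_smul_eq_zero_of_associatedPrimes fun q hq hqp ↦ hx i q hq <|
    hp.trans_le (ringKrullDim_le_of_surjective _ (Ideal.Quotient.factor_surjective hqp))

variable {P : ℕ → Type} [∀ n, AddCommGroup (P n)] [∀ n, Module R (P n)]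
  [∀ n, Module.Projective R (P n)] {d : ∀ n, P (n + 1) →ₗ[R] P n} {J p : Ideal R} [p.IsPrime]
  {r : ℕ} {x : Fin r → R}

lemma homCohomologyVanishesAt_quotient_prefIdeal (hd : ∀ n, d n ∘ₗ d (n + 1) = 0)
    (hJ : ∀ (M : Type) [AddCommGroup M] [Module R M] (n : ℕ) (f : P n →ₗ[R] M), f ∘ₗ d n = 0 →
      ∀ c ∈ J, c • f ∈ homCoboundaries d M n)
    (hxJ : ∀ i, x i ∈ J.radical)
    (hx : ∀ i : Fin r, ∃ t ∉ p, ∀ y : N ⧸ (prefIdeal x i • ⊤ : Submodule R N),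
      x i • y = 0 → t • y = 0) (n : ℕ) :
    ∀ i, i + n < r →
      HomCohomologyVanishesAt d p (N ⧸ (prefIdeal x i • ⊤ : Submodule R N)) n := by
  induction n with
  | zero =>
    intro i hi
    obtain ⟨π, hπ, hker⟩ := exists_surjective_ker_eq_range_lsmul (N := N) x ⟨i, hi⟩
    obtain ⟨k, hk⟩ := hxJ ⟨i, hi⟩
    exact .of_pow_smul_mem hd hπ hker (hx ⟨i, hi⟩) (by simp) k fun f hf ↦ hJ _ _ f hf _ hk
  | succ n ih =>
    intro i hi
    have hi' : i < r := by lia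
    obtain ⟨π, hπ, hker⟩ := exists_surjective_ker_eq_range_lsmul (N := N) x ⟨i, hi'⟩
    obtain ⟨k, hk⟩ := hxJ ⟨i, hi'⟩
    refine .of_pow_smul_mem hd hπ hker (hx ⟨i, hi'⟩) (fun m hm ↦ ?_) k
      fun f hf ↦ hJ _ _ f hf _ hk
    obtain rfl : n = m := by lia
    exact ih (i + 1) (by lia)

lemma mem_associatedPrimes_quotient_prefIdeal_of_isAssociatedCocycle [IsNoetherianRing R]
    (hd : ∀ n, d n ∘ₗ d (n + 1) = 0)
    (hJ : ∀ (M : Type) [AddCommGroup M] [Module R M] (n : ℕ) (f : P n →ₗ[R] M), f ∘ₗ d n = 0 →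
      ∀ c ∈ J, c • f ∈ homCoboundaries d M n)
    {ε : P 0 →ₗ[R] R ⧸ J} (hε : Function.Surjective ε)
    (hex : LinearMap.ker ε ≤ LinearMap.range (d 0))
    (hxJ : ∀ i, x i ∈ J.radical)
    (hx : ∀ i : Fin r, ∃ t ∉ p, ∀ y : N ⧸ (prefIdeal x i • ⊤ : Submodule R N),
      x i • y = 0 → t • y = 0) (hxp : ∀ i, x i ∈ p) (n : ℕ) :
    ∀ i, i + n = r → ∀ f : P n →ₗ[R] N ⧸ (prefIdeal x i • ⊤ : Submodule R N),
      IsAssociatedCocycle d p f →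
        p ∈ associatedPrimes R (N ⧸ (prefIdeal x r • ⊤ : Submodule R N)) := by
  induction n with
  | zero =>
    rintro _ rfl f hf
    exact hf.mem_associatedPrimes hε hex
  | succ n ih =>
    intro i hi f hf
    have hi' : i < r := by lia
    obtain ⟨π, hπ, hker⟩ := exists_surjective_ker_eq_range_lsmul (N := N) x ⟨i, hi'⟩
    obtain ⟨g, hg⟩ := hf.exists_of_succ hd hπ hker (hx ⟨i, hi'⟩) (hxp _)
      (homCohomologyVanishesAt_quotient_prefIdeal hd hJ hxJ hx n i (by lia))
    exact ih (i + 1) (by lia) g hg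

/-- If `p` is locally the annihilator of a class of degree `j ≤ r` in the cohomology of
`Hom(P, N)`, where `P` is a projective resolution of `R ⧸ J` and `x₁, …, x_r ∈ √J` is regular on `N`
up to torsion at `p`, then `j = r` and `p` is associated to `N ⧸ (x₁, …, x_r) N`. -/
lemma IsAssociatedCocycle.eq_and_mem_associatedPrimes [IsNoetherianRing R]
    (hd : ∀ n, d n ∘ₗ d (n + 1) = 0)
    (hJ : ∀ (M : Type) [AddCommGroup M] [Module R M] (n : ℕ) (f : P n →ₗ[R] M), f ∘ₗ d n = 0 →
      ∀ c ∈ J, c • f ∈ homCoboundaries d M n)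
    {ε : P 0 →ₗ[R] R ⧸ J} (hε : Function.Surjective ε)
    (hex : LinearMap.ker ε ≤ LinearMap.range (d 0))
    (hxJ : ∀ i, x i ∈ J.radical)
    (hx : ∀ i : Fin r, ∃ t ∉ p, ∀ y : N ⧸ (prefIdeal x i • ⊤ : Submodule R N),
      x i • y = 0 → t • y = 0) {j : ℕ} (hj : j ≤ r) {f : P j →ₗ[R] N}
    (hf : IsAssociatedCocycle d p f) :
    j = r ∧ p ∈ associatedPrimes R (N ⧸ (prefIdeal x r • ⊤ : Submodule R N)) := by
  have hJp : J ≤ p := fun c hc ↦ (hf.mem_iff c).2 ⟨1, p.one_notMem, by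
    rw [one_smul]
    exact hJ _ _ f hf.comp_eq_zero c hc⟩
  have hxp (i : Fin r) : x i ∈ p := (Ideal.IsPrime.radical_le_iff ‹_›).2 hJp (hxJ i)
  have hbot : (prefIdeal x 0 • ⊤ : Submodule R N) = ⊥ := by
    rw [prefIdeal_zero, Submodule.bot_smul]
  have hf' := hf.of_linearEquiv (Submodule.quotEquivOfEqBot _ hbot).symm
  obtain rfl | hjr := hj.eq_or_lt
  · exact ⟨rfl, mem_associatedPrimes_quotient_prefIdeal_of_isAssociatedCocycle hd hJ hε hex hxJ hx
      hxp j 0 (zero_add j) _ hf'⟩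
  · obtain ⟨t, ht, h⟩ := homCohomologyVanishesAt_quotient_prefIdeal hd hJ hxJ hx j 0 (by lia) _
      hf'.comp_eq_zero
    exact absurd ((hf'.mem_iff 1).2 ⟨t, ht, by rwa [one_smul]⟩) p.one_notMem

end

section

variable {R : Type} [CommRing R]

lemma CategoryTheory.ShortComplex.exists_moduleCat_homology_smul_eq_zero_iff
    (S : ShortComplex (ModuleCat.{0} R)) (z : S.homology) :
    ∃ y : S.X₂, S.g y = 0 ∧ ∀ c : R, c • z = 0 ↔ c • y ∈ LinearMap.range S.f.hom := by
  let e : S.homology ≃ₗ[R] (LinearMap.ker S.g.hom ⧸ LinearMap.range S.moduleCatToCycles) :=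
    S.moduleCatHomologyIso.toLinearEquiv
  obtain ⟨⟨y, hy⟩, hyz⟩ := Submodule.Quotient.mk_surjective _ (e z)
  refine ⟨y, hy, fun c ↦ ?_⟩
  rw [← e.map_eq_zero_iff, map_smul, ← hyz, ← Submodule.Quotient.mk_smul,
    Submodule.Quotient.mk_eq_zero]
  constructor
  · rintro ⟨w, hw⟩
    exact ⟨w, congrArg Subtype.val hw⟩
  · rintro ⟨w, hw⟩
    exact ⟨w, Subtype.ext hw⟩

lemma CochainComplex.exists_moduleCat_homology_smul_eq_zero_iff
    (K : CochainComplex (ModuleCat.{0} R) ℕ) {n : ℕ} (z : K.homology n) :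
    ∃ y : K.X n, K.d n (n + 1) y = 0 ∧ ∀ c : R, c • z = 0 ↔
      c • y ∈ LinearMap.range (K.d ((ComplexShape.up ℕ).prev n) n).hom := by
  obtain ⟨y, hy, h⟩ := ShortComplex.exists_moduleCat_homology_smul_eq_zero_iff (K.sc n) z
  have hnext (m : ℕ) (hm : (ComplexShape.up ℕ).next n = m) : K.d n m y = 0 := by
    subst hm
    exact hy
  exact ⟨y, hnext _ (CochainComplex.next ℕ n), h⟩

variable {X : ModuleCat.{0} R} (P : ProjectiveResolution X)

namespace CategoryTheory.ProjectiveResolution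

/-- The underlying type of the `n`-th module of a projective resolution. -/
abbrev term (n : ℕ) : Type := P.complex.X n

/-- The differential of a projective resolution as a linear map. -/
abbrev linearD (n : ℕ) : P.term (n + 1) →ₗ[R] P.term n := (P.complex.d (n + 1) n).hom

lemma linearD_comp_linearD (n : ℕ) : P.linearD n ∘ₗ P.linearD (n + 1) = 0 := by
  rw [← ModuleCat.hom_comp, P.complex.d_comp_d, ModuleCat.hom_zero]

instance projective_term (n : ℕ) : Module.Projective R (P.term n) :=
  (IsProjective.iff_projective (P.complex.X n)).2 (P.projective n)

lemma π_surjective : Function.Surjective (P.π.f 0).hom :=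
  (ModuleCat.epi_iff_surjective _).1 inferInstance

lemma ker_π_le_range_linearD :
    LinearMap.ker (P.π.f 0).hom ≤ LinearMap.range (P.linearD 0) := by
  have h : (ShortComplex.mk _ _ P.complex_d_comp_π_f_zero).Exact :=
    ShortComplex.exact_of_g_is_cokernel _ P.isColimitCokernelCofork
  exact h.moduleCat_range_eq_ker.ge

lemma smul_mem_homCoboundaries {c : R} (hc : ∀ y : X, c • y = 0) {M : Type} [AddCommGroup M]
    [Module R M] {n : ℕ} {f : P.term n →ₗ[R] M} (hf : f ∘ₗ P.linearD n = 0) :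
    c • f ∈ homCoboundaries (P := P.term) P.linearD M n := by
  have H : Homotopy (c • 𝟙 P.complex) 0 := liftHomotopy 0 _ _ (by
    ext y
    exact ((P.π.f 0).hom.map_smul c y).trans ((hc _).trans (by simp; rfl))) (by simp)
  have hn := congrArg ModuleCat.Hom.hom (H.comm n)
  cases n with
  | zero =>
    rw [dNext_eq_zero _ _ (by simp), prevD_eq _ (show (ComplexShape.down ℕ).Rel 1 0 by simp)] at hn
    refine (Submodule.mem_bot R).2 (LinearMap.ext fun q ↦ ?_)
    have hq : c • q = (P.linearD 0) ((H.hom 0 1).hom q) := by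
      simpa using LinearMap.congr_fun hn q
    rw [LinearMap.smul_apply, ← map_smul, hq]
    exact LinearMap.congr_fun hf _
  | succ n =>
    rw [dNext_eq _ (show (ComplexShape.down ℕ).Rel (n + 1) n by simp),
      prevD_eq _ (show (ComplexShape.down ℕ).Rel (n + 1 + 1) (n + 1) by simp)] at hn
    refine ⟨f ∘ₗ (H.hom n (n + 1)).hom, LinearMap.ext fun q ↦ ?_⟩
    have hq : c • q = (H.hom n (n + 1)).hom (P.linearD n q) +
        P.linearD (n + 1) ((H.hom (n + 1) (n + 1 + 1)).hom q) := by
      simpa using LinearMap.congr_fun hn q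
    have hfq := LinearMap.congr_fun hf ((H.hom (n + 1) (n + 1 + 1)).hom q)
    rw [LinearMap.comp_apply, LinearMap.zero_apply] at hfq
    rw [LinearMap.smul_apply, ← map_smul, hq, map_add, hfq, add_zero]
    rfl

lemma exists_isAssociatedCocycle {M : Type} [AddCommGroup M] [Module R M] [IsNoetherianRing R]
    {n : ℕ} {p : Ideal R}
    (hp : p ∈ associatedPrimes R (((Ext R (ModuleCat R) n).obj (op X)).obj (ModuleCat.of R M))) :
    ∃ f : P.term n →ₗ[R] M, IsAssociatedCocycle (P := P.term) P.linearD p f := by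
  have hprime : p.IsPrime := hp.isPrime
  have hp' := ((P.isoExt (R := R) n (ModuleCat.of R M)).toLinearEquiv.isAssociatedPrime_iff).1 hp
  obtain ⟨-, z, hz⟩ := (isAssociatedPrime_iff).1 hp'
  obtain ⟨y, hy, h⟩ := CochainComplex.exists_moduleCat_homology_smul_eq_zero_iff _ z
  let f : P.complex.X n ⟶ ModuleCat.of R M := y
  have hB (c : R) : c ∈ p ↔ c • f.hom ∈ homCoboundaries (P := P.term) P.linearD M n := by
    rw [hz, Submodule.mem_colon_singleton, Submodule.mem_bot]
    refine (h c).trans ?_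
    cases n with
    | zero =>
      rw [HomologicalComplex.shape _ _ _ (by simp), ModuleCat.hom_zero, LinearMap.range_zero,
        Submodule.mem_bot]
      exact ModuleCat.hom_ext_iff
    | succ n =>
      rw [CochainComplex.prev_nat_succ]
      exact ⟨fun ⟨g, hg⟩ ↦ ⟨g.hom, congrArg ModuleCat.Hom.hom hg⟩,
        fun ⟨g, hg⟩ ↦ ⟨ModuleCat.ofHom g, ModuleCat.hom_ext hg⟩⟩
  refine ⟨f.hom, congrArg ModuleCat.Hom.hom hy, fun c ↦ ⟨fun hc ↦ ⟨1, p.one_notMem, ?_⟩, ?_⟩⟩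
  · rw [one_smul]
    exact (hB c).1 hc
  · rintro ⟨t, ht, h⟩
    rw [← mul_smul, ← hB] at h
    exact (hprime.mem_or_mem h).resolve_left ht

end CategoryTheory.ProjectiveResolution

end

/-- Remark: with `r = depth_k(I,N) < ∞`, `x₁,…,x_r` an `N`-sequence in dimension `> k` in `√I`
and `I = (a₁,…,a_s)`, if `p ∈ Ass_R(Ext^j_R(R/(a₁^{t₁},…,a_s^{t_s}),N))` for some `j ≤ r`,
positive `t₁,…,t_s`, and `dim(R/p) ≥ k+1`, then `j = r` and
`p ∈ Ass_R(N/(x₁,…,x_r)N)`. -/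
theorem ass_ext_power_dim_ge_succ (R : Type) [CommRing R] [IsNoetherianRing R] [IsLocalRing R]
    (I : Ideal R) (N : Type) [AddCommGroup N] [Module R N] [Module.Finite R N]
    (k : ℤ) (hk : -1 ≤ k) (r : ℕ) (hr : depthK R k I N = (r : ℕ∞))
    (x : Fin r → R) (hxI : ∀ i, x i ∈ I.radical) (hx : IsSeqInDimGT R N k x)
    (s : ℕ) (a : Fin s → R) (ha : Ideal.span (Set.range a) = I)
    (ts : Fin s → ℕ) (hts : ∀ i, 0 < ts i)
    (j : ℕ) (hj : j ≤ r) (p : Ideal R)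
    (hp : p ∈ associatedPrimes R
      (((Ext R (ModuleCat R) j).obj
        (op (ModuleCat.of R (R ⧸ Ideal.span (Set.range fun i => a i ^ ts i))))).obj
        (ModuleCat.of R N)))
    (hdim : zdim (k + 1) ≤ ringKrullDim (R ⧸ p)) :
    j = r ∧ p ∈ associatedPrimes R (N ⧸ (prefIdeal x r • ⊤ : Submodule R N)) := by
  let J : Ideal R := Ideal.span (Set.range fun i ↦ a i ^ ts i)
  have hp_prime : p.IsPrime := hp.isPrime
  have hIJ : I ≤ J.radical := by
    rw [← ha, Ideal.span_le]
    rintro _ ⟨i, rfl⟩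
    exact ⟨ts i, Ideal.subset_span ⟨i, rfl⟩⟩
  have hxJ (i : Fin r) : x i ∈ J.radical := Ideal.radical_le_radical_iff.2 hIJ (hxI i)
  let P := projectiveResolution (ModuleCat.of R (R ⧸ J))
  obtain ⟨f, hf⟩ := P.exists_isAssociatedCocycle hp
  refine hf.eq_and_mem_associatedPrimes (ε := (P.π.f 0).hom) P.linearD_comp_linearD
    (fun M _ _ n g hg c hc ↦ P.smul_mem_homCoboundaries (fun y ↦ ?_) hg) P.π_surjective
    P.ker_π_le_range_linearD hxJ
    (hx.exists_notMem_smul_eq_zero (zdim_lt_of_zdim_add_one_le hk hdim)) hj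
  obtain ⟨b, rfl⟩ := Ideal.Quotient.mk_surjective y
  exact Ideal.Quotient.eq_zero_iff_mem.2 (J.mul_mem_right b hc)
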